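/- arXiv:1701.08538 — 14 statements merged into one kernel-verified Lean document; each statement's English description precedes it below -/
import Mathlib

section
/- For every finite digraph D (no multiple arcs, loops allowed), the intersection number i(D) equals the minimum number of generalized complete bipartite subdigraphs (GBSs) in a GBS cover of D. -/
/-- The type of arcs of a digraph given by a relation `E` on `V`. -/
abbrev Arc (V : Type) (E : V → V → Prop) : Type := {p : V × V // E p.1 p.2}

/-- A sink: a vertex with no outgoing arcs. -/
def IsSink {V : Type} (E : V → V → Prop) (x : V) : Prop := ∀ y, ¬ E x y

/-- A source: a vertex with no incoming arcs. -/
def IsSource {V : Type} (E : V → V → Prop) (x : V) : Prop := ∀ y, ¬ E y x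

/-- The Heuchenne condition. -/
def Heuchenne {V : Type} (E : V → V → Prop) : Prop :=
  ∀ u v w x : V, E v w → E u w → E u x → E v x

/-- The intersection number of a digraph: the least `n` such that the digraph has an
intersection representation by ordered pairs of subsets of a set with `n` elements. -/
noncomputable def iNum {V : Type} (E : V → V → Prop) : ℕ :=
  sInf {n : ℕ | ∃ S T : V → Set (Fin n), ∀ x y : V, E x y ↔ (S x ∩ T y).Nonempty}

/-- The arc relation of the subdivision digraph `S(D)` on `V ⊕ Arc V E`. -/
def SArc {V : Type} (E : V → V → Prop) : V ⊕ Arc V E → V ⊕ Arc V E → Prop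
  | Sum.inl u, Sum.inr e => e.val.1 = u
  | Sum.inr e, Sum.inl w => e.val.2 = w
  | _, _ => False

/-- The arc relation of the middle digraph `M(D)`: arcs of `S(D)` together with the
arcs of the line digraph between arc-vertices. -/
def MArc {V : Type} (E : V → V → Prop) : V ⊕ Arc V E → V ⊕ Arc V E → Prop
  | Sum.inr e, Sum.inr f => e.val.2 = f.val.1
  | a, b => SArc E a b

/-- The arc relation of `N(D)`: arcs of `S(D)` together with the arcs of `D` between
vertex-vertices. -/
def NArc {V : Type} (E : V → V → Prop) : V ⊕ Arc V E → V ⊕ Arc V E → Prop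
  | Sum.inl u, Sum.inl w => E u w
  | a, b => SArc E a b

/-- The arc relation of the total digraph `T(D)`. -/
def TArc {V : Type} (E : V → V → Prop) : V ⊕ Arc V E → V ⊕ Arc V E → Prop
  | Sum.inl u, Sum.inl w => E u w
  | Sum.inl u, Sum.inr e => e.val.1 = u
  | Sum.inr e, Sum.inl w => e.val.2 = w
  | Sum.inr e, Sum.inr f => e.val.2 = f.val.1

/-- The arc relation of `T⁻(D)`: the total digraph with the loops at arc-vertices deleted. -/
def TMinusArc {V : Type} (E : V → V → Prop) (a b : V ⊕ Arc V E) : Prop :=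
  TArc E a b ∧ ∀ e : Arc V E, ¬ (a = Sum.inr e ∧ b = Sum.inr e)

/-- `F` is a cover of the digraph `E` by generalized complete bipartite subdigraphs. -/
def IsGBSCover {V : Type} (E : V → V → Prop) (F : Finset (Set V × Set V)) : Prop :=
  (∀ p ∈ F, ∀ x ∈ p.1, ∀ y ∈ p.2, E x y) ∧
  (∀ x y : V, E x y → ∃ p ∈ F, x ∈ p.1 ∧ y ∈ p.2)

/-- The minimum number of GBSs needed to cover the arcs of the digraph `E`. -/
noncomputable def gbsNum {V : Type} (E : V → V → Prop) : ℕ :=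
  sInf {k : ℕ | ∃ F : Finset (Set V × Set V), F.card = k ∧ IsGBSCover E F}

/-- The loops of `D` touch (other than themselves) only sinks and sources. -/
def LoopsTouchOnlySinksSources {V : Type} (E : V → V → Prop) : Prop :=
  ∀ l : V, E l l → ∀ w : V, w ≠ l → (E w l ∨ E l w) → IsSink E w ∨ IsSource E w

/-- the intersection number of a finite digraph equals the minimum number
of GBSs in a GBS cover. -/
theorem intersection_number_eq_gbs_cover_number
    (V : Type) [Fintype V] (E : V → V → Prop) :
    iNum E = gbsNum E := by
  classical
  have hBA : ∀ k : ℕ, (∃ F : Finset (Set V × Set V), F.card = k ∧ IsGBSCover E F) →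
      ∃ S T : V → Set (Fin k), ∀ x y : V, E x y ↔ (S x ∩ T y).Nonempty := by
    rintro k ⟨F, hk, h1, h2⟩
    let e : F ≃ Fin k := F.equivFinOfCardEq hk
    refine ⟨fun x => {i | x ∈ (e.symm i).1.1}, fun y => {i | y ∈ (e.symm i).1.2}, ?_⟩
    intro x y
    constructor
    · intro h
      obtain ⟨p, hp, hx, hy⟩ := h2 x y h
      refine ⟨e ⟨p, hp⟩, ?_, ?_⟩
      · simpa using hx
      · simpa using hy
    · rintro ⟨i, hx, hy⟩
      exact h1 _ (e.symm i).2 x hx y hy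
  have hAB : ∀ n : ℕ, (∃ S T : V → Set (Fin n), ∀ x y : V, E x y ↔ (S x ∩ T y).Nonempty) →
      ∃ k ≤ n, ∃ F : Finset (Set V × Set V), F.card = k ∧ IsGBSCover E F := by
    rintro n ⟨S, T, h⟩
    let f : Fin n → Set V × Set V := fun i => ({x | i ∈ S x}, {y | i ∈ T y})
    refine ⟨(Finset.univ.image f).card, ?_, Finset.univ.image f, rfl, ?_, ?_⟩
    · exact Finset.card_image_le.trans (by simp)
    · intro p hp x hx y hy
      obtain ⟨i, -, rfl⟩ := Finset.mem_image.mp hp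
      exact (h x y).2 ⟨i, hx, hy⟩
    · intro x y hxy
      obtain ⟨i, hx, hy⟩ := (h x y).1 hxy
      exact ⟨f i, Finset.mem_image_of_mem f (Finset.mem_univ i), hx, hy⟩
  have hne : {k : ℕ | ∃ F : Finset (Set V × Set V), F.card = k ∧ IsGBSCover E F}.Nonempty := by
    refine ⟨_, Finset.univ.filter (fun p : Set V × Set V => ∀ x ∈ p.1, ∀ y ∈ p.2, E x y),
      rfl, ?_, ?_⟩
    · intro p hp
      exact (Finset.mem_filter.mp hp).2
    · intro x y hxy
      refine ⟨({x}, {y}), Finset.mem_filter.mpr ⟨Finset.mem_univ _, ?_⟩, rfl, rfl⟩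
      rintro a rfl b rfl
      exact hxy
  apply le_antisymm
  · exact Nat.sInf_le (hBA _ (Nat.sInf_mem hne))
  · obtain ⟨k, hk, hF⟩ := hAB _ (Nat.sInf_mem (hne.mono hBA))
    exact (Nat.sInf_le hF).trans hk
end

section
/- For every finite digraph D, the subdivision digraph S(D) satisfies the Heuchenne condition. -/
/-- the subdivision digraph satisfies the Heuchenne condition. -/
theorem subdivision_heuchenne
    (V : Type) [Fintype V] (E : V → V → Prop) :
    Heuchenne (SArc E) := by
  intro u v w x h1 h2 h3
  rcases u with u | u <;> rcases v with v | v <;> rcases w with w | w <;>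
    rcases x with x | x <;> simp only [SArc] at * <;> simp_all
end

section
/- For every finite digraph D, the intersection number of the subdivision digraph satisfies i(S(D)) = 2v − A − B, where v is the number of vertices of D, A the number of sinks of D and B the number of sources of D. -/
/-- Index set of the optimal representation. -/
abbrev SubIdx {V : Type} (E : V → V → Prop) : Type :=
  {x : V // ¬ IsSink E x} ⊕ {x : V // ¬ IsSource E x}

theorem subIdx_card (V : Type) [Fintype V] (E : V → V → Prop) :
    Nat.card (SubIdx E) =
      2 * Nat.card V - Nat.card {x : V // IsSink E x} - Nat.card {x : V // IsSource E x} := by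
  classical
  have key : ∀ p : V → Prop,
      Nat.card V = Nat.card {x // p x} + Nat.card {x // ¬ p x} := by
    intro p
    rw [← Nat.card_sum]
    exact Nat.card_congr (Equiv.sumCompl p).symm
  have h1 := key (IsSink E)
  have h2 := key (IsSource E)
  rw [Nat.card_sum]
  omega

theorem subIdx_upper (V : Type) [Fintype V] (E : V → V → Prop) :
    ∃ S T : V ⊕ Arc V E → Set (Fin (Nat.card (SubIdx E))),
      ∀ x y, SArc E x y ↔ (S x ∩ T y).Nonempty := by
  classical
  let f : SubIdx E ≃ Fin (Nat.card (SubIdx E)) := Finite.equivFin _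
  let S : V ⊕ Arc V E → Set (SubIdx E) := fun x => match x with
    | Sum.inl u => {i | ∃ h, i = Sum.inl ⟨u, h⟩}
    | Sum.inr e => {i | ∃ h, i = Sum.inr ⟨e.val.2, h⟩}
  let T : V ⊕ Arc V E → Set (SubIdx E) := fun x => match x with
    | Sum.inl u => {i | ∃ h, i = Sum.inr ⟨u, h⟩}
    | Sum.inr e => {i | ∃ h, i = Sum.inl ⟨e.val.1, h⟩}
  refine ⟨fun x => Set.image f (S x), fun x => Set.image f (T x), fun x y => ?_⟩
  rw [← Set.image_inter f.injective, Set.image_nonempty]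
  rcases x with u | e <;> rcases y with w | g
  · simp only [SArc, false_iff]
    rintro ⟨i, ⟨_, rfl⟩, ⟨_, h⟩⟩
    cases h
  · constructor
    · intro h
      have h : g.val.1 = u := h
      subst h
      have hs : ¬ IsSink E g.val.1 := fun h => h _ g.2
      exact ⟨Sum.inl ⟨_, hs⟩, ⟨hs, rfl⟩, ⟨hs, rfl⟩⟩
    · rintro ⟨i, ⟨_, rfl⟩, ⟨_, h⟩⟩
      exact (congrArg Subtype.val (Sum.inl.inj h)).symm
  · constructor
    · intro h
      have h : e.val.2 = w := h
      subst h
      have hs : ¬ IsSource E e.val.2 := fun h => h _ e.2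
      exact ⟨Sum.inr ⟨_, hs⟩, ⟨hs, rfl⟩, ⟨hs, rfl⟩⟩
    · rintro ⟨i, ⟨_, rfl⟩, ⟨_, h⟩⟩
      exact congrArg Subtype.val (Sum.inr.inj h)
  · simp only [SArc, false_iff]
    rintro ⟨i, ⟨_, rfl⟩, ⟨_, h⟩⟩
    cases h

theorem subIdx_lower (V : Type) [Fintype V] (E : V → V → Prop) (n : ℕ)
    (S T : V ⊕ Arc V E → Set (Fin n))
    (hST : ∀ x y, SArc E x y ↔ (S x ∩ T y).Nonempty) : Nat.card (SubIdx E) ≤ n := by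
  have h1 : ∀ u : {x : V // ¬ IsSink E x}, ∃ c, ∃ e : Arc V E, e.val.1 = u.1 ∧
      c ∈ S (Sum.inl u.1) ∧ c ∈ T (Sum.inr e) := by
    rintro ⟨u, hu⟩
    simp only [IsSink, not_forall, not_not] at hu
    obtain ⟨y, hy⟩ := hu
    let e : Arc V E := ⟨(u, y), hy⟩
    obtain ⟨c, hc, hd⟩ := (hST (Sum.inl u) (Sum.inr e)).1 rfl
    exact ⟨c, e, rfl, hc, hd⟩
  have h2 : ∀ u : {x : V // ¬ IsSource E x}, ∃ c, ∃ e : Arc V E, e.val.2 = u.1 ∧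
      c ∈ S (Sum.inr e) ∧ c ∈ T (Sum.inl u.1) := by
    rintro ⟨u, hu⟩
    simp only [IsSource, not_forall, not_not] at hu
    obtain ⟨y, hy⟩ := hu
    let e : Arc V E := ⟨(y, u), hy⟩
    obtain ⟨c, hc, hd⟩ := (hST (Sum.inr e) (Sum.inl u)).1 rfl
    exact ⟨c, e, rfl, hc, hd⟩
  choose f a ha hfS hfT using h1
  choose g b hb hgS hgT using h2
  have hinj : Function.Injective (Sum.elim f g) := by
    apply Function.Injective.sumElim
    · intro u v h
      have : SArc E (Sum.inl u.1) (Sum.inr (a v)) :=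
        (hST _ _).2 ⟨f u, hfS u, h ▸ hfT v⟩
      exact Subtype.ext ((ha v).symm.trans this).symm
    · intro u v h
      have : SArc E (Sum.inr (b u)) (Sum.inl v.1) :=
        (hST _ _).2 ⟨g u, hgS u, h ▸ hgT v⟩
      exact Subtype.ext ((hb u).symm.trans this)
    · intro u v h
      have : SArc E (Sum.inl u.1) (Sum.inl v.1) :=
        (hST _ _).2 ⟨f u, hfS u, h ▸ hgT v⟩
      exact this
  simpa using Nat.card_le_card_of_injective _ hinj

/-- `i(S(D)) = 2v - A - B`. -/
theorem iNum_subdivision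
    (V : Type) [Fintype V] (E : V → V → Prop) :
    iNum (SArc E) =
      2 * Nat.card V - Nat.card {x : V // IsSink E x} - Nat.card {x : V // IsSource E x} := by
  rw [← subIdx_card]
  apply le_antisymm
  · exact Nat.sInf_le (subIdx_upper V E)
  · unfold iNum
    refine le_csInf ?_ ?_
    · exact ⟨_, subIdx_upper V E⟩
    rintro n ⟨S, T, h⟩
    exact subIdx_lower V E n S T h
end

section
/- If a finite digraph satisfies the Heuchenne condition, then it has a unique GBS cover of minimum cardinality: any two GBS covers whose cardinality equals the minimum number of GBSs needed to cover the digraph are equal as families of pairs of vertex sets. -/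
/-- The maximal GBS containing the arc `(a.1, a.2)`. -/
def gbsBlock {V : Type} (E : V → V → Prop) (a : V × V) : Set V × Set V :=
  ({v | E v a.2}, {w | E a.1 w})

/-- The saturation of a pair of vertex sets. -/
def gbsSat {V : Type} (E : V → V → Prop) (p : Set V × Set V) : Set V × Set V :=
  ({v | ∀ y ∈ p.2, E v y}, {w | ∀ x ∈ p.1, E x w})

theorem gbsSat_eq {V : Type} {E : V → V → Prop} (hH : Heuchenne E) {p : Set V × Set V}
    (hp : ∀ x ∈ p.1, ∀ y ∈ p.2, E x y) {x y : V} (hx : x ∈ p.1) (hy : y ∈ p.2) :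
    gbsSat E p = gbsBlock E (x, y) := by
  refine Prod.ext (Set.ext fun v => ?_) (Set.ext fun w => ?_)
  · exact ⟨fun h => h y hy, fun h y' hy' => hH x v y y' h (hp x hx y hy) (hp x hx y' hy')⟩
  · exact ⟨fun h => h x hx, fun h x' hx' => hH x x' y w (hp x' hx' y hy) (hp x hx y hy) h⟩

open Classical in
/-- The family of all blocks. -/
noncomputable def gbsBlocks {V : Type} [Fintype V] (E : V → V → Prop) :
    Finset (Set V × Set V) :=
  (Finset.univ.filter fun a : V × V => E a.1 a.2).image (gbsBlock E)

theorem gbsBlocks_cover {V : Type} [Fintype V] {E : V → V → Prop} (hH : Heuchenne E) :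
    IsGBSCover E (gbsBlocks E) := by
  classical
  constructor
  · intro p hp v hv w hw
    simp only [gbsBlocks, Finset.mem_image, Finset.mem_filter, Finset.mem_univ, true_and] at hp
    obtain ⟨a, ha, rfl⟩ := hp
    exact hH a.1 v a.2 w hv ha hw
  · intro x y h
    refine ⟨gbsBlock E (x, y), ?_, h, h⟩
    simp only [gbsBlocks, Finset.mem_image, Finset.mem_filter, Finset.mem_univ, true_and]
    exact ⟨(x, y), h, rfl⟩

theorem gbs_min_eq_blocks {V : Type} [Fintype V] {E : V → V → Prop} (hH : Heuchenne E)
    {F : Finset (Set V × Set V)} (hF : IsGBSCover E F) (hc : F.card = gbsNum E) :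
    F = gbsBlocks E := by
  classical
  have hle : F.card ≤ (gbsBlocks E).card := by
    rw [hc]
    exact Nat.sInf_le ⟨_, rfl, gbsBlocks_cover hH⟩
  have hsub : gbsBlocks E ⊆ F.image (gbsSat E) := by
    intro b hb
    simp only [gbsBlocks, Finset.mem_image, Finset.mem_filter, Finset.mem_univ, true_and] at hb
    obtain ⟨⟨x, y⟩, ha, rfl⟩ := hb
    obtain ⟨p, hp, hx, hy⟩ := hF.2 x y ha
    exact Finset.mem_image.2 ⟨p, hp, gbsSat_eq hH (hF.1 p hp) hx hy⟩
  have hinj : Set.InjOn (gbsSat E) F := by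
    apply Finset.card_image_iff.1
    exact le_antisymm Finset.card_image_le (hle.trans (Finset.card_le_card hsub))
  symm
  refine Finset.eq_of_subset_of_card_le ?_ hle
  intro b hb
  simp only [gbsBlocks, Finset.mem_image, Finset.mem_filter, Finset.mem_univ, true_and] at hb
  obtain ⟨⟨x, y⟩, ha, rfl⟩ := hb
  obtain ⟨p, hp, hx, hy⟩ := hF.2 x y ha
  have hpe := gbsSat_eq hH (hF.1 p hp) hx hy
  have hmem : gbsBlock E (x, y) ∈ gbsBlocks E := by
    simp only [gbsBlocks, Finset.mem_image, Finset.mem_filter, Finset.mem_univ, true_and]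
    exact ⟨(x, y), ha, rfl⟩
  have e2 : ∀ a b, E a y → E x b → gbsSat E (gbsBlock E (x, y)) = gbsBlock E (a, b) :=
    fun a b h h' => gbsSat_eq hH ((gbsBlocks_cover hH).1 _ hmem) h h'
  suffices gbsBlock E (x, y) = p by rwa [this]
  refine Prod.ext (Set.ext fun v => ⟨fun hv => ?_, fun hv => hF.1 p hp v hv y hy⟩)
    (Set.ext fun w => ⟨fun hw => ?_, fun hw => hF.1 p hp x hx w hw⟩)
  · obtain ⟨q, hq, hvq, hyq⟩ := hF.2 v y hv
    have e1 := gbsSat_eq hH (hF.1 q hq) hvq hyq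
    have : q = p := hinj hq hp (by rw [e1, hpe]; exact (e2 v y hv ha).symm.trans (e2 x y ha ha))
    exact this ▸ hvq
  · obtain ⟨q, hq, hxq, hwq⟩ := hF.2 x w hw
    have e1 := gbsSat_eq hH (hF.1 q hq) hxq hwq
    have : q = p := hinj hq hp (by
      rw [e1, hpe]; exact (e2 x w ha hw).symm.trans (e2 x y ha ha))
    exact this ▸ hwq

/-- under the Heuchenne condition, the minimum-cardinality GBS cover is unique. -/
theorem heuchenne_unique_min_gbs_cover
    (V : Type) [Fintype V] (E : V → V → Prop) (hH : Heuchenne E)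
    (F₁ F₂ : Finset (Set V × Set V))
    (h₁ : IsGBSCover E F₁) (hc₁ : F₁.card = gbsNum E)
    (h₂ : IsGBSCover E F₂) (hc₂ : F₂.card = gbsNum E) :
    F₁ = F₂ := by
  rw [gbs_min_eq_blocks hH h₁ hc₁, gbs_min_eq_blocks hH h₂ hc₂]
end

section
/- For every finite digraph D (loops allowed), the intersection number of the middle digraph is at most that of the subdivision digraph: i(M(D)) ≤ i(S(D)). -/
/-- Every finite digraph has an intersection representation. -/
theorem exists_rep {W : Type} [Finite W] (R : W → W → Prop) :
    {n : ℕ | ∃ S T : W → Set (Fin n), ∀ x y : W, R x y ↔ (S x ∩ T y).Nonempty}.Nonempty := by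
  obtain ⟨n, ⟨f⟩⟩ := Finite.exists_equiv_fin W
  refine ⟨n, fun x => {f x}, fun y => {i | R (f.symm i) y}, fun x y => ?_⟩
  simp [Set.singleton_inter_nonempty]

/-- `i(M(D)) ≤ i(S(D))`. -/
theorem iNum_middle_le_iNum_subdivision
    (V : Type) [Fintype V] (E : V → V → Prop) :
    iNum (MArc E) ≤ iNum (SArc E) := by
  have hmem := Nat.sInf_mem (exists_rep (SArc E))
  change iNum (SArc E) ∈ _ at hmem
  apply Nat.sInf_le
  generalize iNum (SArc E) = n at hmem ⊢
  obtain ⟨S, T, h⟩ := hmem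
  refine ⟨S, Sum.elim (fun w => T (Sum.inl w))
    (fun f => T (Sum.inr f) ∪ T (Sum.inl f.val.1)), fun x y => ?_⟩
  rcases x with u | e <;> rcases y with w | f
  · simp only [Sum.elim_inl, ← h]
    simp [MArc, SArc]
  · simp only [Sum.elim_inr, Set.inter_union_distrib_left, Set.union_nonempty, ← h]
    simp [MArc, SArc]
  · simp only [Sum.elim_inl, ← h]
    simp [MArc, SArc]
  · simp only [Sum.elim_inr, Set.inter_union_distrib_left, Set.union_nonempty, ← h]
    simp [MArc, SArc]
end

section
/- For every finite digraph D (no multiple arcs, loops allowed), the intersection number of the middle digraph satisfies i(M(D)) = 2v − A − B, where v is the number of vertices of D, A the number of sinks of D and B the number of sources of D. -/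
/-- Index type: non-sinks plus non-sources. -/
abbrev MIdx {V : Type} (E : V → V → Prop) : Type :=
  {x : V // ¬ IsSink E x} ⊕ {x : V // ¬ IsSource E x}

theorem card_MIdx (V : Type) [Fintype V] (E : V → V → Prop) :
    Nat.card (MIdx E) =
      2 * Nat.card V - Nat.card {x : V // IsSink E x} - Nat.card {x : V // IsSource E x} := by
  classical
  have h1 := Nat.card_congr (Equiv.sumCompl (IsSink E))
  have h2 := Nat.card_congr (Equiv.sumCompl (IsSource E))
  rw [Nat.card_sum] at h1 h2
  rw [Nat.card_sum]
  omega

/-- The out-side sets of the representation. -/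
def repS {V : Type} (E : V → V → Prop) : V ⊕ Arc V E → Set (MIdx E)
  | Sum.inl u => {i | ∃ x, i = Sum.inl x ∧ x.1 = u}
  | Sum.inr e => {i | (∃ x, i = Sum.inl x ∧ x.1 = e.1.2) ∨ (∃ x, i = Sum.inr x ∧ x.1 = e.1.2)}

/-- The in-side sets of the representation. -/
def repT {V : Type} (E : V → V → Prop) : V ⊕ Arc V E → Set (MIdx E)
  | Sum.inl u => {i | ∃ x, i = Sum.inr x ∧ x.1 = u}
  | Sum.inr e => {i | ∃ x, i = Sum.inl x ∧ x.1 = e.1.1}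

theorem rep_spec {V : Type} (E : V → V → Prop) (a b : V ⊕ Arc V E) :
    MArc E a b ↔ ∃ i, i ∈ repS E a ∧ i ∈ repT E b := by
  have hs : ∀ f : Arc V E, ¬ IsSink E f.1.1 := fun f h => h _ f.2
  have ht : ∀ f : Arc V E, ¬ IsSource E f.1.2 := fun f h => h _ f.2
  rcases a with u | e <;> rcases b with w | f
  · simp [MArc, SArc, repS, repT]
  · have := hs f
    simp only [MArc, SArc, repS, repT, Set.mem_ofPred_eq]
    constructor
    · intro h
      exact ⟨Sum.inl ⟨_, this⟩, ⟨_, rfl, h⟩, ⟨_, rfl, rfl⟩⟩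
    · rintro ⟨_, ⟨x, rfl, h⟩, ⟨y, hy, hh⟩⟩
      cases hy
      exact hh.symm.trans h
  · have := ht e
    simp only [MArc, SArc, repS, repT, Set.mem_ofPred_eq]
    constructor
    · intro h
      exact ⟨Sum.inr ⟨_, this⟩, Or.inr ⟨_, rfl, rfl⟩, ⟨_, rfl, h⟩⟩
    · rintro ⟨_, ⟨x, rfl, h⟩ | ⟨x, rfl, h⟩, ⟨y, hy, hh⟩⟩
      · cases hy
      · cases hy
        exact h.symm.trans hh
  · have := hs f
    simp only [MArc, repS, repT, Set.mem_ofPred_eq]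
    constructor
    · intro h
      exact ⟨Sum.inl ⟨_, this⟩, Or.inl ⟨_, rfl, h.symm⟩, ⟨_, rfl, rfl⟩⟩
    · rintro ⟨_, ⟨x, rfl, h⟩ | ⟨x, rfl, h⟩, ⟨y, hy, hh⟩⟩
      · cases hy
        exact h.symm.trans hh
      · cases hy

theorem MArc_lower {V : Type} [Fintype V] (E : V → V → Prop) (n : ℕ)
    (S T : V ⊕ Arc V E → Set (Fin n))
    (h : ∀ x y, MArc E x y ↔ (S x ∩ T y).Nonempty) : Nat.card (MIdx E) ≤ n := by
  have key : ∀ i : MIdx E, ∃ a b : V ⊕ Arc V E, MArc E a b ∧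
      (match i with
        | Sum.inl x => a = Sum.inl x.1 ∧ ∃ f : Arc V E, b = Sum.inr f ∧ f.1.1 = x.1
        | Sum.inr x => b = Sum.inl x.1 ∧ ∃ f : Arc V E, a = Sum.inr f ∧ f.1.2 = x.1) := by
    rintro (⟨x, hx⟩ | ⟨x, hx⟩)
    · simp only [IsSink, not_forall, not_not] at hx
      obtain ⟨y, hy⟩ := hx
      exact ⟨Sum.inl x, Sum.inr ⟨(x, y), hy⟩, rfl, rfl, _, rfl, rfl⟩
    · simp only [IsSource, not_forall, not_not] at hx
      obtain ⟨y, hy⟩ := hx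
      exact ⟨Sum.inr ⟨(y, x), hy⟩, Sum.inl x, rfl, rfl, _, rfl, rfl⟩
  choose a b hab hi using key
  choose c hc using fun i => (h _ _).1 (hab i)
  have cross : ∀ i j, c i = c j → MArc E (a i) (b j) := fun i j hij =>
    (h _ _).2 ⟨c i, (hc i).1, hij ▸ (hc j).2⟩
  have inj : Function.Injective c := by
    intro i j hij
    have m1 := cross i j hij
    have m2 := cross j i hij.symm
    have p := hi i
    have q := hi j
    rcases i with x | x <;> rcases j with y | y <;> simp only at p q <;>
      obtain ⟨p1, f, p2, p3⟩ := p <;> obtain ⟨q1, g, q2, q3⟩ := q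
    · rw [p1, q2] at m1
      exact congrArg Sum.inl (Subtype.ext (m1.symm.trans q3))
    · rw [p1, q1] at m1
      exact m1.elim
    · rw [p1, q1] at m2
      exact m2.elim
    · rw [p2, q1] at m1
      exact congrArg Sum.inr (Subtype.ext (p3.symm.trans m1))
  simpa using Nat.card_le_card_of_injective c inj

/-- `i(M(D)) = 2v - A - B`. -/
theorem iNum_middle
    (V : Type) [Fintype V] (E : V → V → Prop) :
    iNum (MArc E) =
      2 * Nat.card V - Nat.card {x : V // IsSink E x} - Nat.card {x : V // IsSource E x} := by
  classical
  rw [← card_MIdx]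
  unfold iNum
  have hmem : Nat.card (MIdx E) ∈ {n : ℕ | ∃ S T : V ⊕ Arc V E → Set (Fin n),
      ∀ x y, MArc E x y ↔ (S x ∩ T y).Nonempty} := by
    let φ : MIdx E ≃ Fin (Nat.card (MIdx E)) := Finite.equivFin _
    refine ⟨fun x => Set.image φ (repS E x), fun x => Set.image φ (repT E x), fun x y => ?_⟩
    rw [rep_spec, ← Set.image_inter φ.injective, Set.image_nonempty]
    rfl
  apply le_antisymm
  · exact Nat.sInf_le hmem
  · obtain ⟨S, T, h⟩ := Nat.sInf_mem ⟨_, hmem⟩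
    exact MArc_lower E _ S T h
end

section
/- For every finite digraph D (loops allowed), the intersection number of N(D) is at least that of the subdivision digraph: i(N(D)) ≥ i(S(D)). -/
/-- `i(N(D)) ≥ i(S(D))`. -/
theorem iNum_N_ge_iNum_subdivision
    (V : Type) [Fintype V] (E : V → V → Prop) :
    iNum (NArc E) ≥ iNum (SArc E) := by
  classical
  have hne : {n : ℕ | ∃ S T : V ⊕ Arc V E → Set (Fin n),
      ∀ x y, NArc E x y ↔ (S x ∩ T y).Nonempty}.Nonempty := by
    obtain ⟨n, ⟨f⟩⟩ := Finite.exists_equiv_fin (V ⊕ Arc V E)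
    refine ⟨n, fun x => {f x}, fun y => {c | NArc E (f.symm c) y}, fun x y => ?_⟩
    simp
  obtain ⟨S, T, h⟩ := Nat.sInf_mem hne
  refine Nat.sInf_le ⟨
    fun x => {c | c ∈ S x ∧ (x.isLeft → ∃ e, c ∈ T (Sum.inr e))},
    fun y => {c | c ∈ T y ∧ (y.isLeft → ∃ e, c ∈ S (Sum.inr e))}, ?_⟩
  rintro (u | e) (w | f)
  · simp only [SArc, false_iff]
    rintro ⟨c, ⟨_, h1⟩, ⟨_, h2⟩⟩
    obtain ⟨e, he⟩ := h1 rfl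
    obtain ⟨f, hf⟩ := h2 rfl
    exact (h (Sum.inr f) (Sum.inr e)).2 ⟨c, hf, he⟩
  · refine (h (Sum.inl u) (Sum.inr f)).trans ⟨?_, ?_⟩
    · rintro ⟨c, h1, h2⟩
      exact ⟨c, ⟨h1, fun _ => ⟨f, h2⟩⟩, ⟨h2, by simp⟩⟩
    · rintro ⟨c, h1, h2⟩
      exact ⟨c, h1.1, h2.1⟩
  · refine (h (Sum.inr e) (Sum.inl w)).trans ⟨?_, ?_⟩
    · rintro ⟨c, h1, h2⟩
      exact ⟨c, ⟨h1, by simp⟩, ⟨h2, fun _ => ⟨e, h1⟩⟩⟩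
    · rintro ⟨c, h1, h2⟩
      exact ⟨c, h1.1, h2.1⟩
  · simp only [SArc, false_iff]
    rintro ⟨c, h1, h2⟩
    exact (h (Sum.inr e) (Sum.inr f)).2 ⟨c, h1.1, h2.1⟩
end

section
/- For every finite digraph D (no multiple arcs, loops allowed), the intersection number of N(D) satisfies i(N(D)) = 2v − A − B, where v is the number of vertices of D, A the number of sinks of D and B the number of sources of D. -/
theorem iNum_N_card (V : Type) [Fintype V] (E : V → V → Prop) :
    Nat.card ({x : V // ¬ IsSink E x} ⊕ {x : V // ¬ IsSource E x}) =
      2 * Nat.card V - Nat.card {x : V // IsSink E x} - Nat.card {x : V // IsSource E x} := by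
  classical
  have h1 := Fintype.card_subtype_compl (IsSink E)
  have h2 := Fintype.card_subtype_compl (IsSource E)
  have h3 := Fintype.card_subtype_le (IsSink E)
  have h4 := Fintype.card_subtype_le (IsSource E)
  simp only [Nat.card_eq_fintype_card, Fintype.card_sum]
  omega

theorem iNum_N_upper (V : Type) [Fintype V] (E : V → V → Prop) (n : ℕ)
    (g : ({x : V // ¬ IsSink E x} ⊕ {x : V // ¬ IsSource E x}) ≃ Fin n) :
    ∃ S T : V ⊕ Arc V E → Set (Fin n),
      ∀ x y, NArc E x y ↔ (S x ∩ T y).Nonempty := by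
  -- star at a non-sink `u`, and star at a non-source `w`
  let S : V ⊕ Arc V E → ({x : V // ¬ IsSink E x} ⊕ {x : V // ¬ IsSource E x}) → Prop :=
    fun x p => match x, p with
      | Sum.inl u, Sum.inl a => a.1 = u
      | Sum.inr e, Sum.inr b => e.1.2 = b.1
      | _, _ => False
  let T : V ⊕ Arc V E → ({x : V // ¬ IsSink E x} ⊕ {x : V // ¬ IsSource E x}) → Prop :=
    fun y p => match y, p with
      | Sum.inl w, Sum.inl a => E a.1 w
      | Sum.inr e, Sum.inl a => e.1.1 = a.1
      | Sum.inl w, Sum.inr b => b.1 = w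
      | _, _ => False
  refine ⟨fun x => {i | S x (g.symm i)}, fun y => {i | T y (g.symm i)}, fun x y => ?_⟩
  have key : NArc E x y ↔ ∃ p, S x p ∧ T y p := by
    rcases x with u | e <;> rcases y with w | f
    · constructor
      · intro h
        exact ⟨Sum.inl ⟨u, fun hs => hs w h⟩, rfl, h⟩
      · rintro ⟨⟨a, ha⟩ | b, h1, h2⟩
        · have h1' : a = u := h1
          subst h1'
          exact h2
        · exact h1.elim
    · constructor
      · intro h
        have h' : f.1.1 = u := h
        exact ⟨Sum.inl ⟨u, fun hs => hs f.1.2 (h' ▸ f.2)⟩, rfl, h⟩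
      · rintro ⟨⟨a, ha⟩ | b, h1, h2⟩
        · exact Eq.trans (show f.1.1 = a from h2) h1
        · exact h1.elim
    · constructor
      · intro h
        have h' : e.1.2 = w := h
        exact ⟨Sum.inr ⟨w, fun hs => hs e.1.1 (h' ▸ e.2)⟩, h, rfl⟩
      · rintro ⟨a | ⟨b, hb⟩, h1, h2⟩
        · exact h1.elim
        · exact Eq.trans (show e.1.2 = b from h1) h2
    · constructor
      · intro h
        exact h.elim
      · rintro ⟨a | b, h1, h2⟩
        · exact h1.elim
        · exact h2.elim
  rw [key]
  constructor
  · rintro ⟨p, h1, h2⟩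
    exact ⟨g p, by simpa using h1, by simpa using h2⟩
  · rintro ⟨i, h1, h2⟩
    exact ⟨g.symm i, h1, h2⟩

theorem iNum_N_lower (V : Type) [Fintype V] (E : V → V → Prop) (n : ℕ)
    (S T : V ⊕ Arc V E → Set (Fin n))
    (h : ∀ x y, NArc E x y ↔ (S x ∩ T y).Nonempty) :
    Nat.card ({x : V // ¬ IsSink E x} ⊕ {x : V // ¬ IsSource E x}) ≤ n := by
  have hout : ∀ a : {x : V // ¬ IsSink E x}, ∃ e : Arc V E, e.1.1 = a.1 := by
    rintro ⟨a, ha⟩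
    simp only [IsSink, not_forall, not_not] at ha
    obtain ⟨y, hy⟩ := ha
    exact ⟨⟨(a, y), hy⟩, rfl⟩
  have hin : ∀ b : {x : V // ¬ IsSource E x}, ∃ e : Arc V E, e.1.2 = b.1 := by
    rintro ⟨b, hb⟩
    simp only [IsSource, not_forall, not_not] at hb
    obtain ⟨y, hy⟩ := hb
    exact ⟨⟨(y, b), hy⟩, rfl⟩
  choose o ho using hout
  choose q hq using hin
  have h1 : ∀ a : {x : V // ¬ IsSink E x}, ∃ i, i ∈ S (Sum.inl a.1) ∩ T (Sum.inr (o a)) :=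
    fun a => (h (Sum.inl a.1) (Sum.inr (o a))).1 (ho a)
  have h2 : ∀ b : {x : V // ¬ IsSource E x}, ∃ i, i ∈ S (Sum.inr (q b)) ∩ T (Sum.inl b.1) :=
    fun b => (h (Sum.inr (q b)) (Sum.inl b.1)).1 (hq b)
  choose F hF using h1
  choose G hG using h2
  have inj : Function.Injective (Sum.elim F G) := by
    have hne : ∀ a b, F a ≠ G b := by
      intro a b hab
      exact (h (Sum.inr (q b)) (Sum.inr (o a))).2 ⟨F a, hab ▸ (hG b).1, (hF a).2⟩
    apply Function.Injective.sumElim _ _ hne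
    · intro a a' haa
      have : (o a').1.1 = a.1 :=
        (h (Sum.inl a.1) (Sum.inr (o a'))).2 ⟨F a, (hF a).1, haa ▸ (hF a').2⟩
      exact Subtype.ext (this.symm.trans (ho a'))
    · intro b b' hbb
      have : (q b).1.2 = b'.1 :=
        (h (Sum.inr (q b)) (Sum.inl b'.1)).2 ⟨G b, (hG b).1, hbb ▸ (hG b').2⟩
      exact Subtype.ext ((hq b).symm.trans this)
  simpa using Nat.card_le_card_of_injective _ inj

/-- `i(N(D)) = 2v - A - B`. -/
theorem iNum_N
    (V : Type) [Fintype V] (E : V → V → Prop) :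
    iNum (NArc E) =
      2 * Nat.card V - Nat.card {x : V // IsSink E x} - Nat.card {x : V // IsSource E x} := by
  rw [← iNum_N_card V E]
  have hm := iNum_N_upper V E _ (Finite.equivFin _)
  apply le_antisymm
  · exact Nat.sInf_le hm
  · refine le_csInf ⟨_, hm⟩ ?_
    rintro n ⟨S, T, h⟩
    exact iNum_N_lower V E n S T h
end

section
/- Let D be a finite digraph with no loops and no multiple arcs. If (X,Y) is a GBS of the total digraph T(D) (i.e., X × Y is contained in the arc set of T(D)) and two arcs of S(D) both lie in X × Y, then these two arcs belong to the same GBS of the canonical GBS cover of S(D); that is, either both arcs end at the same vertex-vertex x of D, or both arcs start at the same vertex-vertex x of D. -/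
/-- in a loopless digraph, any two arcs of `S(D)` lying in a common GBS of
`T(D)` belong to the same GBS of the canonical cover of `S(D)`: either both end at the same
vertex-vertex, or both start at the same vertex-vertex. -/
theorem gbs_of_total_no_mixing
    (V : Type) [Fintype V] (E : V → V → Prop)
    (hnoloop : ∀ v : V, ¬ E v v)
    (X Y : Set (V ⊕ Arc V E))
    (hGBS : ∀ a ∈ X, ∀ b ∈ Y, TArc E a b)
    (a₁ b₁ a₂ b₂ : V ⊕ Arc V E)
    (harc₁ : SArc E a₁ b₁) (harc₂ : SArc E a₂ b₂)
    (ha₁ : a₁ ∈ X) (hb₁ : b₁ ∈ Y) (ha₂ : a₂ ∈ X) (hb₂ : b₂ ∈ Y) :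
    (∃ x : V, b₁ = Sum.inl x ∧ b₂ = Sum.inl x) ∨
    (∃ x : V, a₁ = Sum.inl x ∧ a₂ = Sum.inl x) := by
  have h12 := hGBS a₁ ha₁ b₂ hb₂
  have h21 := hGBS a₂ ha₂ b₁ hb₁
  rcases a₁ with u₁ | e₁ <;> rcases b₁ with w₁ | f₁ <;>
    rcases a₂ with u₂ | e₂ <;> rcases b₂ with w₂ | f₂ <;>
    simp only [SArc, TArc] at harc₁ harc₂ h12 h21
  · right
    exact ⟨u₁, rfl, by rw [← harc₂, h12]⟩
  · exfalso
    rw [← harc₁, ← harc₂, h21] at h12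
    exact hnoloop _ h12
  · exfalso
    rw [← harc₁, ← harc₂, h12] at h21
    exact hnoloop _ h21
  · left
    exact ⟨w₁, rfl, by rw [← harc₁, h12]⟩
end

section
/- Let D be a finite digraph (no multiple arcs) whose loops touch only themselves, sinks and sources. If (X,Y) is a GBS of T^-(D) (i.e., X × Y is contained in the arc set of T^-(D)) and two arcs of S(D) lying in X × Y belong to two different GBSs of the canonical GBS cover of S(D), then there is a vertex l of D carrying a loop such that one of the two arcs is an arc of S(D) ending at l and the other is an arc of S(D) starting at l. -/
/-- if loops of `D` touch only themselves, sinks and sources, and a GBS of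
`T⁻(D)` contains two arcs of `S(D)` from different GBSs of the canonical cover of `S(D)`,
then there is a looped vertex `l` such that one of the arcs ends at `l` and the other
starts at `l`. -/
theorem gbs_of_Tminus_mixing_only_at_loops
    (V : Type) [Fintype V] (E : V → V → Prop)
    (hloops : LoopsTouchOnlySinksSources E)
    (X Y : Set (V ⊕ Arc V E))
    (hGBS : ∀ a ∈ X, ∀ b ∈ Y, TMinusArc E a b)
    (a₁ b₁ a₂ b₂ : V ⊕ Arc V E)
    (harc₁ : SArc E a₁ b₁) (harc₂ : SArc E a₂ b₂)
    (ha₁ : a₁ ∈ X) (hb₁ : b₁ ∈ Y) (ha₂ : a₂ ∈ X) (hb₂ : b₂ ∈ Y)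
    (hdiff : ¬ ((∃ x : V, b₁ = Sum.inl x ∧ b₂ = Sum.inl x) ∨
                (∃ x : V, a₁ = Sum.inl x ∧ a₂ = Sum.inl x))) :
    ∃ l : V, E l l ∧
      ((b₁ = Sum.inl l ∧ a₂ = Sum.inl l) ∨ (b₂ = Sum.inl l ∧ a₁ = Sum.inl l)) := by
  have h12 := (hGBS a₁ ha₁ b₂ hb₂).1
  have h21 := (hGBS a₂ ha₂ b₁ hb₁).1
  rcases a₁ with u₁ | e₁ <;> rcases b₁ with w₁ | f₁ <;>
    rcases a₂ with u₂ | e₂ <;> rcases b₂ with w₂ | f₂ <;>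
    simp only [SArc, TArc] at harc₁ harc₂ h12 h21
  · exact absurd (Or.inr ⟨u₁, rfl, by rw [← harc₂, h12]⟩) hdiff
  · have h : w₂ = u₁ := by rw [← harc₂, h21, harc₁]
    subst h
    exact ⟨w₂, h12, Or.inr ⟨rfl, rfl⟩⟩
  · have h : w₁ = u₂ := by rw [← harc₁, h12, harc₂]
    subst h
    exact ⟨w₁, h21, Or.inl ⟨rfl, rfl⟩⟩
  · exact absurd (Or.inl ⟨w₁, rfl, by rw [← harc₁, h12]⟩) hdiff
end

section
/- Let D be a finite digraph (no multiple arcs) whose loops touch only themselves, sinks and sources, and let L be the number of loops of D. Then the intersection number of the total digraph satisfies i(T(D)) ≥ i(T^-(D)) − L. -/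
/-- Any representation over a finite type can be transported to `Fin (Nat.card U)`. -/
theorem rep_of_finite {W U : Type} [Finite U] (R : W → W → Prop) (S T : W → Set U)
    (h : ∀ x y, R x y ↔ ∃ i, i ∈ S x ∧ i ∈ T y) :
    Nat.card U ∈ {n : ℕ | ∃ S T : W → Set (Fin n), ∀ x y, R x y ↔ (S x ∩ T y).Nonempty} := by
  let φ := Finite.equivFin U
  refine ⟨fun x => {j | φ.symm j ∈ S x}, fun x => {j | φ.symm j ∈ T x}, fun x y => ?_⟩
  rw [h]
  constructor
  · rintro ⟨i, h1, h2⟩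
    exact ⟨φ i, by simpa using h1, by simpa using h2⟩
  · rintro ⟨j, h1, h2⟩
    exact ⟨φ.symm j, h1, h2⟩

/-- The arc-vertex of a loop. -/
def loopArc {V : Type} {E : V → V → Prop} (l : {l : V // E l l}) : V ⊕ Arc V E :=
  Sum.inr ⟨(l.1, l.1), l.2⟩

theorem loopArc_eq {V : Type} {E : V → V → Prop} (e : Arc V E)
    (h : TArc E (Sum.inr e) (Sum.inr e)) : ∃ l, (Sum.inr e : V ⊕ Arc V E) = loopArc l := by
  obtain ⟨⟨a, b⟩, he⟩ := e
  have h' : b = a := h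
  subst h'
  exact ⟨⟨b, he⟩, rfl⟩

theorem loopArc_inj {V : Type} {E : V → V → Prop} (l m : {l : V // E l l})
    (h : TArc E (loopArc l) (loopArc m)) : l = m := Subtype.ext h

theorem loopArc_trans {V : Type} {E : V → V → Prop} (l : {l : V // E l l}) (x y : V ⊕ Arc V E)
    (h1 : TArc E x (loopArc l)) (h2 : TArc E (loopArc l) y) : TArc E x y := by
  obtain ⟨l, hl⟩ := l
  rcases x with x | ⟨⟨a, b⟩, hx⟩ <;> rcases y with y | ⟨⟨c, d⟩, hy⟩ <;>
    simp only [TArc, loopArc] at h1 h2 ⊢ <;> subst h1 <;> subst h2 <;> first | rfl | assumption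

/-- `i(T(D)) ≥ i(T⁻(D)) - L` when the loops of `D` touch only themselves,
sinks and sources, where `L` is the number of loops of `D`. -/
theorem iNum_total_ge
    (V : Type) [Fintype V] (E : V → V → Prop)
    (hloops : LoopsTouchOnlySinksSources E) :
    iNum (TArc E) ≥ iNum (TMinusArc E) - Nat.card {l : V // E l l} := by
  have hne : {n : ℕ | ∃ S T : V ⊕ Arc V E → Set (Fin n),
      ∀ x y, TArc E x y ↔ (S x ∩ T y).Nonempty}.Nonempty :=
    ⟨_, rep_of_finite (U := V ⊕ Arc V E) (TArc E) (fun x => {x}) (fun y => {x | TArc E x y})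
      (fun x y => by simp)⟩
  obtain ⟨S, T, hST⟩ := Nat.sInf_mem hne
  change ∀ x y, TArc E x y ↔ _ at hST
  change iNum (TMinusArc E) - _ ≤ sInf _
  generalize sInf {n : ℕ | ∃ S T : V ⊕ Arc V E → Set (Fin n),
      ∀ x y, TArc E x y ↔ (S x ∩ T y).Nonempty} = n at S T hST ⊢
  have key : iNum (TMinusArc E) ≤ Nat.card (Fin n ⊕ {l : V // E l l}) := by
    apply Nat.sInf_le
    let bad : Fin n → {l : V // E l l} → Prop := fun i l => i ∈ S (loopArc l) ∧ i ∈ T (loopArc l)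
    refine rep_of_finite _
      (fun x => {u | Sum.elim (fun i => ((∀ l, ¬ bad i l) ∧ i ∈ S x) ∨
        ∃ l, bad i l ∧ TArc E x (loopArc l) ∧ x ≠ loopArc l) (fun l => TArc E x (loopArc l)) u})
      (fun y => {u | Sum.elim (fun i => ((∀ l, ¬ bad i l) ∧ i ∈ T y) ∨
        ∃ l, bad i l ∧ TArc E (loopArc l) y) (fun l => TArc E (loopArc l) y ∧ y ≠ loopArc l) u}) ?_
    intro x y
    constructor
    · rintro ⟨hxy, hno⟩
      obtain ⟨i, hi1, hi2⟩ := (hST x y).1 hxy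
      by_cases hb : ∃ l, bad i l
      · obtain ⟨l, hl⟩ := hb
        have h1 : TArc E x (loopArc l) := (hST _ _).2 ⟨i, hi1, hl.2⟩
        have h2 : TArc E (loopArc l) y := (hST _ _).2 ⟨i, hl.1, hi2⟩
        by_cases hx : x = loopArc l
        · have hy : y ≠ loopArc l := fun hy => hno _ ⟨hx, hy⟩
          exact ⟨Sum.inr l, h1, h2, hy⟩
        · exact ⟨Sum.inl i, Or.inr ⟨l, hl, h1, hx⟩, Or.inr ⟨l, hl, h2⟩⟩
      · have hb' : ∀ l, ¬ bad i l := fun l hl => hb ⟨l, hl⟩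
        exact ⟨Sum.inl i, Or.inl ⟨hb', hi1⟩, Or.inl ⟨hb', hi2⟩⟩
    · rintro ⟨i | l, h1, h2⟩
      · rcases h1 with ⟨hg, h1⟩ | ⟨l, hl, h1, hx⟩
        · rcases h2 with ⟨-, h2⟩ | ⟨m, hm, -⟩
          · have hT : TArc E x y := (hST x y).2 ⟨i, h1, h2⟩
            refine ⟨hT, ?_⟩
            rintro e ⟨rfl, rfl⟩
            obtain ⟨l, hl⟩ := loopArc_eq e hT
            rw [hl] at h1 h2
            exact hg l ⟨h1, h2⟩
          · exact absurd hm (hg m)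
        · rcases h2 with ⟨hg, -⟩ | ⟨m, hm, h2⟩
          · exact absurd hl (hg l)
          · have hlm : l = m := loopArc_inj l m ((hST _ _).2 ⟨i, hl.1, hm.2⟩)
            subst hlm
            have hT := loopArc_trans l x y h1 h2
            refine ⟨hT, ?_⟩
            rintro e ⟨rfl, rfl⟩
            obtain ⟨k, hk⟩ := loopArc_eq e hT
            rw [hk] at h1 hx
            exact hx (by rw [loopArc_inj k l h1])
      · obtain ⟨h2, hy⟩ := h2
        have h1' : TArc E x (loopArc l) := h1
        have hT := loopArc_trans l x y h1' h2
        refine ⟨hT, ?_⟩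
        rintro e ⟨rfl, rfl⟩
        obtain ⟨k, hk⟩ := loopArc_eq e hT
        rw [hk] at h1' hy
        exact hy (by rw [loopArc_inj k l h1'])
  rw [Nat.card_sum, Nat.card_fin] at key
  omega
end

section
/- Let D be a finite digraph (no multiple arcs) whose loops touch only themselves, sinks and sources. Then the intersection number of the total digraph satisfies i(T(D)) = 2v − A − B − L, where v is the number of vertices of D, A the number of sinks of D, B the number of sources of D, and L the number of loops of D. -/
/-- Index set of an optimal representation. -/
abbrev TIdx (V : Type) (E : V → V → Prop) : Type :=
  {u : V // ¬ IsSink E u} ⊕ {w : V // ¬ IsSource E w ∧ ¬ E w w}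

theorem card_TIdx (V : Type) [Fintype V] (E : V → V → Prop) :
    Nat.card (TIdx V E) =
      2 * Nat.card V - Nat.card {x : V // IsSink E x} - Nat.card {x : V // IsSource E x}
        - Nat.card {l : V // E l l} := by
  classical
  simp only [Nat.card_eq_fintype_card, Fintype.card_sum]
  have h1 := Fintype.card_subtype_compl (fun x => IsSink E x)
  have h1' := Fintype.card_subtype_le (fun x => IsSink E x)
  have h2 : Fintype.card {x : V // IsSource E x} + Fintype.card {l : V // E l l}
      + Fintype.card {w : V // ¬ IsSource E w ∧ ¬ E w w} = Fintype.card V := by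
    have h3 := Fintype.card_subtype_or_disjoint (fun x => IsSource E x) (fun x => E x x) (by
      rw [Pi.disjoint_iff]
      intro x
      rw [Prop.disjoint_iff]
      exact fun h => h.1 x h.2)
    have h4 := Fintype.card_subtype_compl (fun x => IsSource E x ∨ E x x)
    have h4' := Fintype.card_subtype_le (fun x => IsSource E x ∨ E x x)
    simp only [not_or] at h4
    omega
  omega

theorem TIdx_rep (V : Type) (E : V → V → Prop) (hloops : LoopsTouchOnlySinksSources E) :
    ∃ S T : V ⊕ Arc V E → Set (TIdx V E), ∀ x y, TArc E x y ↔ (S x ∩ T y).Nonempty := by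
  refine ⟨fun a => match a with
    | Sum.inl x => {i | match i with
      | Sum.inl u => u.1 = x
      | Sum.inr w => IsSink E w.1 ∧ E x w.1}
    | Sum.inr e => {i | match i with
      | Sum.inl u => E u.1 u.1 ∧ e.1.2 = u.1
      | Sum.inr w => e.1.2 = w.1},
    fun b => match b with
    | Sum.inl y => {i | match i with
      | Sum.inl u => E u.1 y ∧ (E u.1 u.1 → y = u.1)
      | Sum.inr w => w.1 = y}
    | Sum.inr f => {i | match i with
      | Sum.inl u => f.1.1 = u.1
      | Sum.inr w => f.1.1 = w.1}, ?_⟩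
  have nsk : ∀ x y, E x y → ¬ IsSink E x := fun x y h hs => hs y h
  have nsc : ∀ x y, E x y → ¬ IsSource E y := fun x y h hs => hs x h
  rintro (x | ⟨⟨a, b⟩, e⟩) (y | ⟨⟨c, d⟩, f⟩)
  · simp only [TArc]
    constructor
    · intro h
      by_cases hx : E x x → y = x
      · exact ⟨Sum.inl ⟨x, nsk _ _ h⟩, rfl, h, hx⟩
      · push Not at hx
        have hs : IsSink E y := (hloops x hx.1 y hx.2 (Or.inr h)).resolve_right (nsc _ _ h)
        exact ⟨Sum.inr ⟨y, nsc _ _ h, hs y⟩, ⟨hs, h⟩, rfl⟩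
    · rintro ⟨u | w, h1, h2⟩
      · obtain rfl : u.1 = x := h1
        exact h2.1
      · obtain rfl : w.1 = y := h2
        exact h1.2
  · simp only [TArc]
    constructor
    · rintro rfl
      exact ⟨Sum.inl ⟨c, nsk _ _ f⟩, rfl, rfl⟩
    · rintro ⟨u | w, h1, h2⟩
      · exact h2.trans h1
      · have h3 : c = w.1 := h2
        exact absurd h1.1 (nsk _ d (h3 ▸ f))
  · simp only [TArc]
    constructor
    · rintro rfl
      by_cases hb : E b b
      · exact ⟨Sum.inl ⟨b, nsk _ _ hb⟩, ⟨hb, rfl⟩, hb, fun _ => rfl⟩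
      · exact ⟨Sum.inr ⟨b, nsc _ _ e, hb⟩, rfl, rfl⟩
    · rintro ⟨u | w, h1, h2⟩
      · exact h1.2.trans (h2.2 h1.1).symm
      · exact Eq.trans h1 h2
  · simp only [TArc]
    constructor
    · rintro rfl
      by_cases hb : E b b
      · exact ⟨Sum.inl ⟨b, nsk _ _ hb⟩, ⟨hb, rfl⟩, rfl⟩
      · exact ⟨Sum.inr ⟨b, nsc _ _ e, hb⟩, rfl, rfl⟩
    · rintro ⟨u | w, h1, h2⟩
      · exact h1.2.trans (Eq.symm h2)
      · exact Eq.trans h1 (Eq.symm h2)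

theorem TIdx_lower (V : Type) [Fintype V] (E : V → V → Prop) (n : ℕ)
    (S T : V ⊕ Arc V E → Set (Fin n)) (h : ∀ x y, TArc E x y ↔ (S x ∩ T y).Nonempty) :
    Nat.card (TIdx V E) ≤ n := by
  have h1 : ∀ u : {u : V // ¬ IsSink E u}, ∃ e : Arc V E, e.1.1 = u.1 := by
    rintro ⟨u, hu⟩
    simp only [IsSink, not_forall, not_not] at hu
    obtain ⟨y, hy⟩ := hu
    exact ⟨⟨(u, y), hy⟩, rfl⟩
  have h2 : ∀ w : {w : V // ¬ IsSource E w ∧ ¬ E w w}, ∃ e : Arc V E, e.1.2 = w.1 := by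
    rintro ⟨w, hw, _⟩
    simp only [IsSource, not_forall, not_not] at hw
    obtain ⟨y, hy⟩ := hw
    exact ⟨⟨(y, w), hy⟩, rfl⟩
  choose p hp using h1
  choose q hq using h2
  have h3 : ∀ u, (S (Sum.inl u.1) ∩ T (Sum.inr (p u))).Nonempty := fun u => (h _ _).1 (hp u)
  have h4 : ∀ w, (S (Sum.inr (q w)) ∩ T (Sum.inl w.1)).Nonempty := fun w => (h _ _).1 (hq w)
  choose f hf using h3
  choose g hg using h4
  have mixed : ∀ u w, f u ≠ g w := by
    intro u w he
    have a1 : E u.1 w.1 := (h (Sum.inl u.1) (Sum.inl w.1)).2 ⟨f u, (hf u).1, he ▸ (hg w).2⟩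
    have a2 : (q w).1.2 = (p u).1.1 :=
      (h (Sum.inr (q w)) (Sum.inr (p u))).2 ⟨f u, he ▸ (hg w).1, (hf u).2⟩
    rw [hp, hq] at a2
    exact w.2.2 (by rw [← a2] at a1; exact a1)
  have inj : Function.Injective (Sum.elim f g : TIdx V E → Fin n) := by
    rintro (u | w) (u' | w') he
    · have he' : f u = f u' := he
      have a : (p u').1.1 = u.1 :=
        (h (Sum.inl u.1) (Sum.inr (p u'))).2 ⟨f u, (hf u).1, he' ▸ (hf u').2⟩
      rw [hp] at a
      rw [Subtype.ext a]
    · exact absurd he (mixed u w')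
    · exact absurd he.symm (mixed u' w)
    · have he' : g w = g w' := he
      have a : (q w).1.2 = w'.1 :=
        (h (Sum.inr (q w)) (Sum.inl w'.1)).2 ⟨g w, (hg w).1, he' ▸ (hg w').2⟩
      rw [hq] at a
      rw [Subtype.ext a]
  simpa using Nat.card_le_card_of_injective _ inj

/-- `i(T(D)) = 2v - A - B - L` when the loops of `D` touch only themselves,
sinks and sources. -/
theorem iNum_total
    (V : Type) [Fintype V] (E : V → V → Prop)
    (hloops : LoopsTouchOnlySinksSources E) :
    iNum (TArc E) =
      2 * Nat.card V - Nat.card {x : V // IsSink E x} - Nat.card {x : V // IsSource E x}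
        - Nat.card {l : V // E l l} := by
  rw [← card_TIdx V E]
  have hmem : Nat.card (TIdx V E) ∈ {n : ℕ | ∃ S T : V ⊕ Arc V E → Set (Fin n),
      ∀ x y, TArc E x y ↔ (S x ∩ T y).Nonempty} := by
    obtain ⟨S, T, h⟩ := TIdx_rep V E hloops
    let φ := Finite.equivFin (TIdx V E)
    refine ⟨fun x => Set.image φ (S x), fun y => Set.image φ (T y), fun x y => ?_⟩
    rw [h, ← Set.image_inter φ.injective, Set.image_nonempty]
  apply le_antisymm
  · exact Nat.sInf_le hmem
  · refine le_csInf ⟨_, hmem⟩ ?_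
    rintro n ⟨S, T, h⟩
    exact TIdx_lower V E n S T h
end

section
/- For every finite simple undirected graph G on n vertices, the intersection number of G is at most ⌊n²/4⌋; that is, there exists a set U with |U| = ⌊n²/4⌋ and an assignment of a subset S_v ⊆ U to each vertex v such that two distinct vertices u, v are adjacent in G iff S_u ∩ S_v ≠ ∅. -/
open Classical in
theorem egp_clique_cover {V : Type} (G : SimpleGraph V) (n : ℕ) :
    ∀ s : Finset V, s.card = n → ∃ F : Finset (Finset V), F.card ≤ n ^ 2 / 4 ∧
      (∀ c ∈ F, ∀ a ∈ c, ∀ b ∈ c, a ≠ b → G.Adj a b) ∧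
      (∀ a ∈ s, ∀ b ∈ s, G.Adj a b → ∃ c ∈ F, a ∈ c ∧ b ∈ c) := by
  induction n using Nat.strong_induction_on with
  | _ n ih =>
    intro s hs
    by_cases h : ∃ u ∈ s, ∃ v ∈ s, G.Adj u v
    · obtain ⟨u, hu, v, hv, huv⟩ := h
      have hne : u ≠ v := huv.ne
      have hvu := huv.symm
      have hsub : ({u, v} : Finset V) ⊆ s := by
        intro x hx
        simp only [Finset.mem_insert, Finset.mem_singleton] at hx
        rcases hx with rfl | rfl <;> assumption
      have hc2 : ({u, v} : Finset V).card = 2 := Finset.card_pair hne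
      have h2 : 2 ≤ n := by
        rw [← hs, ← hc2]; exact Finset.card_le_card hsub
      obtain ⟨m, rfl⟩ : ∃ m, n = m + 2 := ⟨n - 2, by omega⟩
      have ht : (s \ {u, v}).card = m := by
        rw [Finset.card_sdiff_of_subset hsub]; omega
      obtain ⟨F, hF, hcl, hcov⟩ := ih m (by omega) _ ht
      let f : V → Finset V := fun w => insert w (({u, v} : Finset V).filter (G.Adj w))
      have hf : ∀ w x, x ∈ f w ↔ x = w ∨ ((x = u ∨ x = v) ∧ G.Adj w x) := by
        intro w x; simp [f]
      refine ⟨insert {u, v} (F ∪ (s \ {u, v}).image f), ?_, ?_, ?_⟩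
      · have h1 := Finset.card_insert_le ({u, v} : Finset V) (F ∪ (s \ {u, v}).image f)
        have h3 := Finset.card_union_le F ((s \ {u, v}).image f)
        have h4 : ((s \ {u, v}).image f).card ≤ m := ht ▸ Finset.card_image_le
        have h5 : (m + 2) ^ 2 = m ^ 2 + (m + 1) * 4 := by ring
        rw [h5, Nat.add_mul_div_right _ _ (by norm_num)]
        omega
      · intro c hc a ha b hb hab
        simp only [Finset.mem_insert, Finset.mem_union, Finset.mem_image] at hc
        rcases hc with rfl | hc | ⟨w, -, rfl⟩
        · simp only [Finset.mem_insert, Finset.mem_singleton] at ha hb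
          rcases ha with rfl | rfl <;> rcases hb with rfl | rfl <;> first | assumption | exact absurd rfl hab
        · exact hcl c hc a ha b hb hab
        · rw [hf] at ha hb
          rcases ha with rfl | ⟨ha, ha'⟩
          · rcases hb with rfl | ⟨hb, hb'⟩
            · exact absurd rfl hab
            · exact hb'
          · rcases hb with rfl | ⟨hb, hb'⟩
            · exact ha'.symm
            · rcases ha with rfl | rfl <;> rcases hb with rfl | rfl <;>
                first | assumption | exact absurd rfl hab
      · have key : ∀ a ∈ s, ∀ b, ¬ (a = u ∨ a = v) → (b = u ∨ b = v) → G.Adj a b →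
            ∃ c ∈ insert {u, v} (F ∪ (s \ {u, v}).image f), a ∈ c ∧ b ∈ c := by
          intro a ha b ha' hb hab
          refine ⟨f a, ?_, (hf _ _).2 (Or.inl rfl), (hf _ _).2 (Or.inr ⟨hb, hab⟩)⟩
          refine Finset.mem_insert_of_mem (Finset.mem_union_right _ (Finset.mem_image_of_mem _ ?_))
          simpa [ha] using ha'
        intro a ha b hb hab
        by_cases ha' : a = u ∨ a = v
        · by_cases hb' : b = u ∨ b = v
          · exact ⟨{u, v}, Finset.mem_insert_self _ _, by simpa using ha', by simpa using hb'⟩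
          · obtain ⟨c, hc, h1, h2⟩ := key b hb a hb' ha' hab.symm
            exact ⟨c, hc, h2, h1⟩
        · by_cases hb' : b = u ∨ b = v
          · exact key a ha b ha' hb' hab
          · obtain ⟨c, hc, h⟩ := hcov a (by simpa [ha] using ha') b (by simpa [hb] using hb') hab
            exact ⟨c, Finset.mem_insert_of_mem (Finset.mem_union_left _ hc), h⟩
    · exact ⟨∅, by simp, by simp, fun a ha b hb hab => absurd ⟨a, ha, b, hb, hab⟩ h⟩

/-- every finite simple graph on `n` vertices has an intersection
representation over a set with `⌊n² / 4⌋` elements. -/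
theorem graph_intersection_number_le
    (V : Type) [Fintype V] (G : SimpleGraph V) :
    ∃ S : V → Set (Fin (Fintype.card V ^ 2 / 4)),
      ∀ u v : V, u ≠ v → (G.Adj u v ↔ (S u ∩ S v).Nonempty) := by
  obtain ⟨F, hF, hcl, hcov⟩ := egp_clique_cover G _ Finset.univ (Finset.card_univ (α := V))
  let e : F → Fin (Fintype.card V ^ 2 / 4) := fun c => Fin.castLE hF (F.equivFin c)
  have he : Function.Injective e :=
    (Fin.castLE_injective hF).comp F.equivFin.injective
  refine ⟨fun v => {i | ∃ c : F, e c = i ∧ v ∈ c.1}, fun u v huv => ⟨fun h => ?_, ?_⟩⟩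
  · obtain ⟨c, hc, h1, h2⟩ := hcov u (Finset.mem_univ _) v (Finset.mem_univ _) h
    exact ⟨e ⟨c, hc⟩, ⟨⟨c, hc⟩, rfl, h1⟩, ⟨⟨c, hc⟩, rfl, h2⟩⟩
  · rintro ⟨i, ⟨c, hc, h1⟩, ⟨d, hd, h2⟩⟩
    obtain rfl : c = d := he (hc.trans hd.symm)
    exact hcl c.1 c.2 u h1 v h2 huv
end

section
/- For every finite simple undirected graph G, the intersection number of G equals the minimum number of complete subgraphs of G needed to cover all edges of G. -/
/-- The intersection number of a finite simple graph: the least `n` such that `G` has an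
intersection representation by subsets of a set with `n` elements. -/
noncomputable def graphINum {V : Type} (G : SimpleGraph V) : ℕ :=
  sInf {n : ℕ | ∃ S : V → Set (Fin n),
    ∀ u v : V, u ≠ v → (G.Adj u v ↔ (S u ∩ S v).Nonempty)}

/-- The minimum number of complete subgraphs of `G` needed to cover all edges of `G`. -/
noncomputable def cliqueCoverNum {V : Type} (G : SimpleGraph V) : ℕ :=
  sInf {k : ℕ | ∃ F : Finset (Set V), F.card = k ∧ (∀ c ∈ F, G.IsClique c) ∧
    ∀ u v : V, G.Adj u v → ∃ c ∈ F, u ∈ c ∧ v ∈ c}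

/-- the intersection number of a finite simple graph equals the minimum
number of complete subgraphs needed to cover its edges. -/
theorem graph_intersection_number_eq_clique_cover_number
    (V : Type) [Fintype V] (G : SimpleGraph V) :
    graphINum G = cliqueCoverNum G := by
  classical
  -- cliques of a cover become the points of an intersection representation
  have hBA : ∀ k : ℕ, (∃ F : Finset (Set V), F.card = k ∧ (∀ c ∈ F, G.IsClique c) ∧
      ∀ u v : V, G.Adj u v → ∃ c ∈ F, u ∈ c ∧ v ∈ c) →
      ∃ S : V → Set (Fin k), ∀ u v : V, u ≠ v → (G.Adj u v ↔ (S u ∩ S v).Nonempty) := by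
    rintro k ⟨F, rfl, hc, hcov⟩
    refine ⟨fun v => {i | v ∈ (F.equivFin.symm i : Set V)}, fun u v huv => ⟨fun h => ?_, ?_⟩⟩
    · obtain ⟨c, hcF, hu, hv⟩ := hcov u v h
      exact ⟨F.equivFin ⟨c, hcF⟩, by simpa using hu, by simpa using hv⟩
    · rintro ⟨i, hu, hv⟩
      exact hc _ (F.equivFin.symm i).2 hu hv huv
  have hB : {k : ℕ | ∃ F : Finset (Set V), F.card = k ∧ (∀ c ∈ F, G.IsClique c) ∧
      ∀ u v : V, G.Adj u v → ∃ c ∈ F, u ∈ c ∧ v ∈ c}.Nonempty := by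
    refine ⟨_, Finset.univ.filter (fun c : Set V => G.IsClique c), rfl, by simp, ?_⟩
    intro u v h
    refine ⟨{u, v}, ?_, by simp, by simp⟩
    simp [SimpleGraph.isClique_pair, h]
  unfold graphINum cliqueCoverNum
  apply le_antisymm
  · exact Nat.sInf_le (hBA _ (Nat.sInf_mem hB))
  · refine le_csInf (hB.mono hBA) ?_
    rintro n ⟨S, hS⟩
    -- the vertices containing a given point form a clique
    have hle : (Finset.univ.image (fun i : Fin n => {v : V | i ∈ S v})).card ≤ n := by
      simpa using Finset.card_image_le (s := Finset.univ) (f := fun i : Fin n => {v : V | i ∈ S v})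
    refine le_trans (Nat.sInf_le ⟨_, rfl, ?_, ?_⟩) hle
    · intro c hc
      obtain ⟨i, -, rfl⟩ := Finset.mem_image.1 hc
      intro u hu v hv huv
      exact (hS u v huv).2 ⟨i, hu, hv⟩
    · intro u v h
      obtain ⟨i, hu, hv⟩ := (hS u v h.ne).1 h
      exact ⟨_, Finset.mem_image_of_mem _ (Finset.mem_univ i), hu, hv⟩
end
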